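/- Let L be a pseudo-Finsler Lagrangian on Ω with spray nonlinear connection N. Let U ⊆ ℝ^m be open and let s : U → ℝ^m be smooth with (x,s(x)) ∈ Ω for all x ∈ U, and suppose s is pregeodesic: D_s s = f·s for some smooth f : U → ℝ. Then for every smooth vector field X : U → ℝ^m and every x ∈ U: (a) D_X s = ∇^{g_s}_X s, and (b) D̃_s X = ∇^{g_s}_s X, where ∇^{g_s} is the Levi-Civita connection of the pullback metric g_s. -/

import Mathlib

open scoped BigOperators

noncomputable section

/-- `Vec m` is the model space `ℝ^m`. -/
abbrev Vec (m : ℕ) : Type := Fin m → ℝ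

variable {m : ℕ}

/-- Partial derivative in the velocity (second) variable: `∂f/∂v^i (x,v)`. -/
def pdv (f : Vec m → Vec m → ℝ) (i : Fin m) (x v : Vec m) : ℝ :=
  fderiv ℝ (f x) v (Pi.single i 1)

/-- Partial derivative in the position (first) variable: `∂f/∂x^i (x,v)`. -/
def pdx (f : Vec m → Vec m → ℝ) (i : Fin m) (x v : Vec m) : ℝ :=
  fderiv ℝ (fun y => f y v) x (Pi.single i 1)

/-- Vertical Hessian `g_{αβ}(x,v) = ∂²L/∂v^α∂v^β` of the Lagrangian. -/
def gmet (L : Vec m → Vec m → ℝ) (x v : Vec m) : Matrix (Fin m) (Fin m) ℝ :=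
  Matrix.of fun α β => pdv (pdv L β) α x v

/-- Inverse metric `g^{αβ}` (nonsingular matrix inverse). -/
def ginv (L : Vec m → Vec m → ℝ) (x v : Vec m) : Matrix (Fin m) (Fin m) ℝ :=
  (gmet L x v)⁻¹

/-- Geodesic spray coefficients
`G^α = (1/4) g^{αδ}(∂g_{δγ}/∂x^β + ∂g_{δβ}/∂x^γ − ∂g_{βγ}/∂x^δ) v^β v^γ`. -/
def spray (L : Vec m → Vec m → ℝ) (α : Fin m) (x v : Vec m) : ℝ :=
  (1/4) * ∑ δ, ginv L x v α δ *
    (∑ β, ∑ γ,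
      (pdx (fun y w => gmet L y w δ γ) β x v
        + pdx (fun y w => gmet L y w δ β) γ x v
        - pdx (fun y w => gmet L y w β γ) δ x v) * v β * v γ)

/-- The spray nonlinear connection `N^α_μ = ∂G^α/∂v^μ`. -/
def nConn (L : Vec m → Vec m → ℝ) (α μ : Fin m) (x v : Vec m) : ℝ :=
  pdv (spray L α) μ x v

/-- Horizontal derivative `δ_μ f = ∂f/∂x^μ − N^ν_μ ∂f/∂v^ν` for a nonlinear connection `N`. -/
def hderiv (N : Fin m → Fin m → Vec m → Vec m → ℝ) (f : Vec m → Vec m → ℝ)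
    (μ : Fin m) (x v : Vec m) : ℝ :=
  pdx f μ x v - ∑ ν, N ν μ x v * pdv f ν x v

/-- Curvature of the nonlinear connection: `R^μ_{αβ} = δ_α N^μ_β − δ_β N^μ_α`. -/
def curv (N : Fin m → Fin m → Vec m → Vec m → ℝ) (μ α β : Fin m) (x v : Vec m) : ℝ :=
  hderiv N (N μ β) α x v - hderiv N (N μ α) β x v

/-- Ricci scalar `Ric(v) = R^μ{}_{μα} v^α`. -/
def ricciScalar (N : Fin m → Fin m → Vec m → Vec m → ℝ) (x v : Vec m) : ℝ :=
  ∑ α, (∑ μ, curv N μ μ α x v) * v α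

/-- Ricci 1-form component `(Ric_v)_α = R^μ{}_{μα}`. -/
def ricciOne (N : Fin m → Fin m → Vec m → Vec m → ℝ) (α : Fin m) (x v : Vec m) : ℝ :=
  ∑ μ, curv N μ μ α x v

/-- `χ_α := (∂R^γ{}_{αν}/∂v^γ) v^ν`. -/
def chiForm (N : Fin m → Fin m → Vec m → Vec m → ℝ) (α : Fin m) (x v : Vec m) : ℝ :=
  ∑ γ, ∑ ν, pdv (curv N γ α ν) γ x v * v ν

/-- Partial derivative `∂u^α/∂x^μ` of a vector field on the base. -/
def pde (u : Vec m → Vec m) (α μ : Fin m) (x : Vec m) : ℝ :=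
  fderiv ℝ (fun y => u y α) x (Pi.single μ 1)

/-- Covariant derivative `(D_X u)^α = (∂u^α/∂x^μ + N^α_μ(x,u(x))) X^μ`. -/
def covD (L : Vec m → Vec m → ℝ) (u X : Vec m → Vec m) (x : Vec m) : Vec m :=
  fun α => ∑ μ, (pde u α μ x + nConn L α μ x (u x)) * X x μ

/-- Flipped derivative `(D̃_u X)^α = (∂X^α/∂x^μ) u^μ + N^α_μ(x,u(x)) X^μ`. -/
def flipD (L : Vec m → Vec m → ℝ) (u X : Vec m → Vec m) (x : Vec m) : Vec m :=
  fun α => (∑ μ, pde X α μ x * u x μ) + ∑ μ, nConn L α μ x (u x) * X x μ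

/-- Lie bracket `[X,Y]^α = X^μ ∂Y^α/∂x^μ − Y^μ ∂X^α/∂x^μ`. -/
def lieB (X Y : Vec m → Vec m) (x : Vec m) : Vec m :=
  fun α => ∑ μ, (X x μ * pde Y α μ x - Y x μ * pde X α μ x)

/-- Scalar product `g_u(X,Y)(x) = g_{αβ}(x,u(x)) X^α Y^β`. -/
def gProd (L : Vec m → Vec m → ℝ) (u X Y : Vec m → Vec m) (x : Vec m) : ℝ :=
  ∑ α, ∑ β, gmet L x (u x) α β * X x α * Y x β

/-- Directional derivative `∂_X f = X^μ ∂f/∂x^μ`. -/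
def dirD (X : Vec m → Vec m) (f : Vec m → ℝ) (x : Vec m) : ℝ :=
  ∑ μ, X x μ * fderiv ℝ f x (Pi.single μ 1)


/-- Derivative `∂(g_s)_{αβ}/∂x^μ` of an `x`-dependent metric. -/
def pdm (gs : Vec m → Matrix (Fin m) (Fin m) ℝ) (α β μ : Fin m) (x : Vec m) : ℝ :=
  fderiv ℝ (fun y => gs y α β) x (Pi.single μ 1)

/-- Christoffel symbols `γ^λ_{μν}` of the metric `gs`. -/
def christ (gs : Vec m → Matrix (Fin m) (Fin m) ℝ) (lam μ ν : Fin m) (x : Vec m) : ℝ :=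
  (1/2) * ∑ σ, (gs x)⁻¹ lam σ * (pdm gs σ ν μ x + pdm gs σ μ ν x - pdm gs μ ν σ x)

/-- Levi-Civita covariant derivative `(∇_X Y)^λ = X^μ ∂Y^λ/∂x^μ + γ^λ_{νμ} Y^ν X^μ`. -/
def lcCov (gs : Vec m → Matrix (Fin m) (Fin m) ℝ) (X Y : Vec m → Vec m) (x : Vec m) : Vec m :=
  fun lam => (∑ μ, X x μ * pde Y lam μ x) + ∑ μ, ∑ ν, christ gs lam ν μ x * Y x ν * X x μ

/-- Riemann curvature `R^λ{}_{νμρ}` of the metric `gs`. -/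
def riem (gs : Vec m → Matrix (Fin m) (Fin m) ℝ) (lam ν μ ρ : Fin m) (x : Vec m) : ℝ :=
  fderiv ℝ (fun y => christ gs lam ν ρ y) x (Pi.single μ 1)
  - fderiv ℝ (fun y => christ gs lam ν μ y) x (Pi.single ρ 1)
  + (∑ σ, christ gs lam σ μ x * christ gs σ ν ρ x)
  - ∑ σ, christ gs lam σ ρ x * christ gs σ ν μ x

/-- Ricci tensor of the metric `gs`. -/
def ricciPull (gs : Vec m → Matrix (Fin m) (Fin m) ℝ) (ν ρ : Fin m) (x : Vec m) : ℝ :=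
  ∑ lam, riem gs lam ν lam ρ x

namespace PF

open scoped ContDiff

/-- smoothness on Ω of a function of position and velocity -/
def Sm (Ω : Set (Vec m × Vec m)) (f : Vec m → Vec m → ℝ) : Prop :=
  ContDiffOn ℝ (⊤ : ℕ∞) (fun p : Vec m × Vec m => f p.1 p.2) Ω

variable {Ω : Set (Vec m × Vec m)}

theorem Sm.diff (hO : IsOpen Ω) {f : Vec m → Vec m → ℝ} (hf : Sm Ω f) {x v : Vec m}
    (h : (x, v) ∈ Ω) : DifferentiableAt ℝ (fun p : Vec m × Vec m => f p.1 p.2) (x, v) :=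
  (ContDiffOn.contDiffAt hf (hO.mem_nhds h)).differentiableAt (by simp)

theorem hasV (hO : IsOpen Ω) {f : Vec m → Vec m → ℝ} (hf : Sm Ω f) {x v : Vec m}
    (h : (x, v) ∈ Ω) : HasFDerivAt (f x)
      ((fderiv ℝ (fun p : Vec m × Vec m => f p.1 p.2) (x, v)).comp
        (ContinuousLinearMap.inr ℝ (Vec m) (Vec m))) v := by
  have h1 := (hf.diff hO h).hasFDerivAt
  exact HasFDerivAt.comp (f := fun w : Vec m => (x, w)) v h1 (hasFDerivAt_prodMk_right x v)

theorem hasX (hO : IsOpen Ω) {f : Vec m → Vec m → ℝ} (hf : Sm Ω f) {x v : Vec m}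
    (h : (x, v) ∈ Ω) : HasFDerivAt (fun y => f y v)
      ((fderiv ℝ (fun p : Vec m × Vec m => f p.1 p.2) (x, v)).comp
        (ContinuousLinearMap.inl ℝ (Vec m) (Vec m))) x := by
  have h1 := (hf.diff hO h).hasFDerivAt
  exact HasFDerivAt.comp (f := fun w : Vec m => (w, v)) x h1 (hasFDerivAt_prodMk_left x v)

theorem pdv_eq (hO : IsOpen Ω) {f : Vec m → Vec m → ℝ} (hf : Sm Ω f) {x v : Vec m}
    (h : (x, v) ∈ Ω) (i : Fin m) : pdv f i x v =
      fderiv ℝ (fun p : Vec m × Vec m => f p.1 p.2) (x, v) (0, Pi.single i 1) := by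
  unfold pdv
  rw [(hasV hO hf h).fderiv]; simp

theorem pdx_eq (hO : IsOpen Ω) {f : Vec m → Vec m → ℝ} (hf : Sm Ω f) {x v : Vec m}
    (h : (x, v) ∈ Ω) (i : Fin m) : pdx f i x v =
      fderiv ℝ (fun p : Vec m × Vec m => f p.1 p.2) (x, v) (Pi.single i 1, 0) := by
  unfold pdx
  rw [(hasX hO hf h).fderiv]; simp

theorem sm_dir (hO : IsOpen Ω) {f : Vec m → Vec m → ℝ} (hf : Sm Ω f) (e : Vec m × Vec m) :
    ContDiffOn ℝ (⊤ : ℕ∞)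
      (fun p => fderiv ℝ (fun p : Vec m × Vec m => f p.1 p.2) p e) Ω := by
  have h1 : ContDiffOn ℝ (⊤ : ℕ∞) (fderiv ℝ (fun p : Vec m × Vec m => f p.1 p.2)) Ω :=
    ContDiffOn.fderiv_of_isOpen hf hO (by simp)
  exact h1.clm_apply contDiffOn_const

theorem Sm.pdv (hO : IsOpen Ω) {f : Vec m → Vec m → ℝ} (hf : Sm Ω f) (i : Fin m) :
    Sm Ω (pdv f i) :=
  (sm_dir hO hf (0, Pi.single i 1)).congr fun p hp => pdv_eq hO hf (x := p.1) (v := p.2) hp i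

theorem Sm.pdx (hO : IsOpen Ω) {f : Vec m → Vec m → ℝ} (hf : Sm Ω f) (i : Fin m) :
    Sm Ω (pdx f i) :=
  (sm_dir hO hf (Pi.single i 1, 0)).congr fun p hp => pdx_eq hO hf (x := p.1) (v := p.2) hp i

theorem fderiv_swap (hO : IsOpen Ω) {f : Vec m → Vec m → ℝ} (hf : Sm Ω f) (e d : Vec m × Vec m)
    {p : Vec m × Vec m} (hp : p ∈ Ω) :
    fderiv ℝ (fun q => fderiv ℝ (fun p : Vec m × Vec m => f p.1 p.2) q e) p d =
    fderiv ℝ (fun q => fderiv ℝ (fun p : Vec m × Vec m => f p.1 p.2) q d) p e := by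
  have hc : ContDiffAt ℝ (⊤ : ℕ∞) (fun p : Vec m × Vec m => f p.1 p.2) p :=
    ContDiffOn.contDiffAt hf (hO.mem_nhds hp)
  have h1 : ContDiffOn ℝ (⊤ : ℕ∞) (fderiv ℝ (fun p : Vec m × Vec m => f p.1 p.2)) Ω :=
    ContDiffOn.fderiv_of_isOpen hf hO (by simp)
  have h2 : DifferentiableAt ℝ (fderiv ℝ (fun p : Vec m × Vec m => f p.1 p.2)) p :=
    (h1.contDiffAt (hO.mem_nhds hp)).differentiableAt (by simp)
  have hs : IsSymmSndFDerivAt ℝ (fun p : Vec m × Vec m => f p.1 p.2) p :=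
    hc.isSymmSndFDerivAt (by
      rw [minSmoothness_of_isRCLikeNormedField]; exact WithTop.coe_le_coe.2 (le_top : (2 : ℕ∞) ≤ ⊤))
  have key : ∀ e : Vec m × Vec m,
      fderiv ℝ (fun q => fderiv ℝ (fun p : Vec m × Vec m => f p.1 p.2) q e) p =
      (fderiv ℝ (fderiv ℝ (fun p : Vec m × Vec m => f p.1 p.2)) p).flip e := by
    intro e
    rw [fderiv_clm_apply h2 (differentiableAt_const e)]
    simp
  rw [key, key]
  exact hs d e

theorem pdv_congr (hO : IsOpen Ω) {f h : Vec m → Vec m → ℝ}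
    (hfh : ∀ p ∈ Ω, f p.1 p.2 = h p.1 p.2) {x v : Vec m} (hp : (x, v) ∈ Ω) (i : Fin m) :
    pdv f i x v = pdv h i x v := by
  unfold pdv
  have : f x =ᶠ[nhds v] h x := by
    have : {w | (x, w) ∈ Ω} ∈ nhds v :=
      (hO.preimage (by fun_prop : Continuous fun w : Vec m => (x, w))).mem_nhds hp
    filter_upwards [this] with w hw using hfh (x, w) hw
  rw [this.fderiv_eq]

theorem pdx_congr (hO : IsOpen Ω) {f h : Vec m → Vec m → ℝ}
    (hfh : ∀ p ∈ Ω, f p.1 p.2 = h p.1 p.2) {x v : Vec m} (hp : (x, v) ∈ Ω) (i : Fin m) :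
    pdx f i x v = pdx h i x v := by
  unfold pdx
  have : (fun y => f y v) =ᶠ[nhds x] (fun y => h y v) := by
    have : {w | (w, v) ∈ Ω} ∈ nhds x :=
      (hO.preimage (by fun_prop : Continuous fun w : Vec m => (w, v))).mem_nhds hp
    filter_upwards [this] with w hw using hfh (w, v) hw
  rw [this.fderiv_eq]

theorem pdv_pdv (hO : IsOpen Ω) {f : Vec m → Vec m → ℝ} (hf : Sm Ω f) {x v : Vec m}
    (h : (x, v) ∈ Ω) (i j : Fin m) : pdv (pdv f i) j x v = pdv (pdv f j) i x v := by
  have h1 : ∀ k, Sm Ω (fun x v => fderiv ℝ (fun p : Vec m × Vec m => f p.1 p.2) (x, v)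
      (0, Pi.single k 1)) := fun k => sm_dir hO hf _
  rw [pdv_congr hO (h := fun x v => fderiv ℝ (fun p : Vec m × Vec m => f p.1 p.2) (x, v)
      (0, Pi.single i 1)) (fun p hp => pdv_eq hO hf (x := p.1) (v := p.2) hp i) h,
    pdv_congr hO (h := fun x v => fderiv ℝ (fun p : Vec m × Vec m => f p.1 p.2) (x, v)
      (0, Pi.single j 1)) (fun p hp => pdv_eq hO hf (x := p.1) (v := p.2) hp j) h,
    pdv_eq hO (h1 i) h, pdv_eq hO (h1 j) h]
  exact fderiv_swap hO hf _ _ h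

theorem pdv_pdx (hO : IsOpen Ω) {f : Vec m → Vec m → ℝ} (hf : Sm Ω f) {x v : Vec m}
    (h : (x, v) ∈ Ω) (i j : Fin m) : pdv (pdx f i) j x v = pdx (pdv f j) i x v := by
  have h1 : ∀ k, Sm Ω (fun x v => fderiv ℝ (fun p : Vec m × Vec m => f p.1 p.2) (x, v)
      k) := fun k => sm_dir hO hf _
  rw [pdv_congr hO (h := fun x v => fderiv ℝ (fun p : Vec m × Vec m => f p.1 p.2) (x, v)
      (Pi.single i 1, 0)) (fun p hp => pdx_eq hO hf (x := p.1) (v := p.2) hp i) h,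
    pdx_congr hO (h := fun x v => fderiv ℝ (fun p : Vec m × Vec m => f p.1 p.2) (x, v)
      (0, Pi.single j 1)) (fun p hp => pdv_eq hO hf (x := p.1) (v := p.2) hp j) h,
    pdv_eq hO (h1 _) h, pdx_eq hO (h1 _) h]
  exact fderiv_swap hO hf _ _ h

theorem dV (hO : IsOpen Ω) {f : Vec m → Vec m → ℝ} (hf : Sm Ω f) {x v : Vec m}
    (h : (x, v) ∈ Ω) : HasFDerivAt (f x) (fderiv ℝ (f x) v) v :=
  (hasV hO hf h).differentiableAt.hasFDerivAt

theorem dX (hO : IsOpen Ω) {f : Vec m → Vec m → ℝ} (hf : Sm Ω f) {x v : Vec m}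
    (h : (x, v) ∈ Ω) : HasFDerivAt (fun y => f y v) (fderiv ℝ (fun y => f y v) x) x :=
  (hasX hO hf h).differentiableAt.hasFDerivAt

theorem pdv_sum_mul (hO : IsOpen Ω) {f h : Fin m → Vec m → Vec m → ℝ}
    (hf : ∀ a, Sm Ω (f a)) (hh : ∀ a, Sm Ω (h a)) {x v : Vec m}
    (hp : (x, v) ∈ Ω) (i : Fin m) :
    pdv (fun x v => ∑ a, f a x v * h a x v) i x v
      = ∑ a, (pdv (f a) i x v * h a x v + f a x v * pdv (h a) i x v) := by
  have H := HasFDerivAt.fun_sum (u := Finset.univ)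
    fun a _ => (dV hO (hf a) hp).mul (dV hO (hh a) hp)
  have e : pdv (fun x v => ∑ a, f a x v * h a x v) i x v =
    fderiv ℝ (fun v => ∑ a, f a x v * h a x v) v (Pi.single i 1) := rfl
  rw [e]
  erw [H.fderiv]
  simp only [sum_apply, add_apply, smul_apply, smul_eq_mul, pdv]
  exact Finset.sum_congr rfl fun a _ => by ring

theorem sm_coord (a : Fin m) : Sm Ω (fun _ v => v a) := by
  unfold Sm; fun_prop

theorem pdv_coord (a i : Fin m) (x v : Vec m) :
    pdv (fun _ v => v a) i x v = if a = i then 1 else 0 := by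
  have : HasFDerivAt (fun v : Vec m => v a) (ContinuousLinearMap.proj (R := ℝ) (φ := fun _ : Fin m => ℝ) a) v :=
    hasFDerivAt_apply a v
  unfold pdv
  rw [this.fderiv]
  simp [Pi.single_apply]

theorem pdv_euler (hO : IsOpen Ω) {f : Fin m → Vec m → Vec m → ℝ}
    (hf : ∀ a, Sm Ω (f a)) {x v : Vec m} (hp : (x, v) ∈ Ω) (i : Fin m) :
    pdv (fun x v => ∑ a, v a * f a x v) i x v
      = f i x v + ∑ a, v a * pdv (f a) i x v := by
  rw [pdv_sum_mul hO (f := fun a _ v => v a) (fun a => sm_coord a) hf hp, Finset.sum_add_distrib]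
  simp [pdv_coord]

theorem pdx_euler (hO : IsOpen Ω) {f : Fin m → Vec m → Vec m → ℝ}
    (hf : ∀ a, Sm Ω (f a)) {x v : Vec m} (hp : (x, v) ∈ Ω) (i : Fin m) :
    pdx (fun x v => ∑ a, v a * f a x v) i x v = ∑ a, v a * pdx (f a) i x v := by
  have H := HasFDerivAt.fun_sum (u := Finset.univ)
    fun a _ => (dX hO (hf a) hp).const_mul (v a)
  unfold pdx
  rw [H.fderiv]
  simp

theorem pdv_const_mul (hO : IsOpen Ω) {f : Vec m → Vec m → ℝ}
    (hf : Sm Ω f) (c : ℝ) {x v : Vec m} (hp : (x, v) ∈ Ω) (i : Fin m) :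
    pdv (fun x v => c * f x v) i x v = c * pdv f i x v := by
  have H := (dV hO hf hp).const_mul c
  unfold pdv
  rw [H.fderiv]; simp

theorem pdx_const_mul (hO : IsOpen Ω) {f : Vec m → Vec m → ℝ}
    (hf : Sm Ω f) (c : ℝ) {x v : Vec m} (hp : (x, v) ∈ Ω) (i : Fin m) :
    pdx (fun x v => c * f x v) i x v = c * pdx f i x v := by
  have H := (dX hO hf hp).const_mul c
  unfold pdx
  rw [H.fderiv]; simp

theorem pdv_sub (hO : IsOpen Ω) {f h : Vec m → Vec m → ℝ}
    (hf : Sm Ω f) (hh : Sm Ω h) {x v : Vec m} (hp : (x, v) ∈ Ω) (i : Fin m) :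
    pdv (fun x v => f x v - h x v) i x v = pdv f i x v - pdv h i x v := by
  have H := (dV hO hf hp).sub (dV hO hh hp)
  have e : pdv (fun x v => f x v - h x v) i x v =
    fderiv ℝ (f x - h x) v (Pi.single i 1) := rfl
  rw [e, H.fderiv]; rfl

theorem sm_sum {f : Fin m → Vec m → Vec m → ℝ} (hf : ∀ a, Sm Ω (f a)) :
    Sm Ω (fun x v => ∑ a, f a x v) := ContDiffOn.sum fun a _ => hf a

theorem sm_mul {f h : Vec m → Vec m → ℝ} (hf : Sm Ω f) (hh : Sm Ω h) :
    Sm Ω (fun x v => f x v * h x v) := ContDiffOn.mul hf hh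

theorem sm_add {f h : Vec m → Vec m → ℝ} (hf : Sm Ω f) (hh : Sm Ω h) :
    Sm Ω (fun x v => f x v + h x v) := ContDiffOn.add hf hh

theorem sm_sub {f h : Vec m → Vec m → ℝ} (hf : Sm Ω f) (hh : Sm Ω h) :
    Sm Ω (fun x v => f x v - h x v) := ContDiffOn.sub hf hh

theorem sm_const (c : ℝ) : Sm Ω (fun _ _ => c) := contDiffOn_const

theorem sm_det {A : Vec m → Vec m → Matrix (Fin m) (Fin m) ℝ}
    (hA : ∀ i j, Sm Ω (fun x v => A x v i j)) : Sm Ω (fun x v => (A x v).det) := by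
  unfold Sm
  simp only [Matrix.det_apply]
  refine ContDiffOn.sum fun σ _ => ?_
  refine ContDiffOn.const_smul _ ?_
  exact contDiffOn_prod fun i _ => hA _ _

theorem sm_inv {A : Vec m → Vec m → Matrix (Fin m) (Fin m) ℝ}
    (hA : ∀ i j, Sm Ω (fun x v => A x v i j))
    (hu : ∀ p ∈ Ω, IsUnit (A p.1 p.2).det) (i j : Fin m) :
    Sm Ω (fun x v => (A x v)⁻¹ i j) := by
  have h1 : Sm Ω (fun x v => ((A x v).det)⁻¹) :=
    ContDiffOn.inv (sm_det hA) fun p hp => (hu p hp).ne_zero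
  have h2 : Sm Ω (fun x v => (A x v).adjugate i j) := by
    simp only [Matrix.adjugate_apply]
    apply sm_det
    intro k l
    by_cases hk : k = j
    · subst hk
      simp only [Matrix.updateRow_self]
      exact sm_const _
    · simp only [Matrix.updateRow_ne hk]
      exact hA k l
  have := sm_mul h1 h2
  convert this using 3
  simp [Matrix.inv_def]

/-! ### Finsler identities -/

variable {L : Vec m → Vec m → ℝ}

theorem sm_g (hO : IsOpen Ω) (hL : Sm Ω L) (a b : Fin m) :
    Sm Ω (fun y w => gmet L y w a b) := (hL.pdv hO b).pdv hO a

theorem g_symm (hO : IsOpen Ω) (hL : Sm Ω L) {x v : Vec m} (hp : (x, v) ∈ Ω) (a b : Fin m) :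
    gmet L x v a b = gmet L x v b a := pdv_pdv hO hL hp b a

theorem euler1 (hO : IsOpen Ω) (hL : Sm Ω L)
    (hLhom : ∀ p ∈ Ω, ∀ s : ℝ, 0 < s → L p.1 (s • p.2) = s ^ 2 * L p.1 p.2)
    {x v : Vec m} (hp : (x, v) ∈ Ω) : ∑ a, v a * pdv L a x v = 2 * L x v := by
  have h0 : HasFDerivAt (L x) (fderiv ℝ (L x) v) ((1 : ℝ) • v) := by
    rw [one_smul]; exact dV hO hL hp
  have h1 : HasDerivAt (fun t : ℝ => t • v) v 1 := by
    simpa using (hasDerivAt_id (1 : ℝ)).smul_const v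
  have h2 : HasDerivAt (fun t : ℝ => L x (t • v)) (fderiv ℝ (L x) v v) 1 :=
    h0.comp_hasDerivAt 1 h1
  have h3 : HasDerivAt (fun t : ℝ => t ^ 2 * L x v) (2 * L x v) 1 := by
    simpa using (hasDerivAt_pow 2 (1 : ℝ)).mul_const (L x v)
  have h4 : (fun t : ℝ => L x (t • v)) =ᶠ[nhds 1] (fun t : ℝ => t ^ 2 * L x v) := by
    filter_upwards [lt_mem_nhds (zero_lt_one : (0 : ℝ) < 1)] with t ht using hLhom (x, v) hp t ht
  have h5 := h2.unique (h3.congr_of_eventuallyEq h4)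
  rw [← h5]
  have hv : v = ∑ a, v a • (Pi.single a 1 : Vec m) := by
    ext j
    simp [Finset.sum_apply, Pi.single_apply]
  have h6 : fderiv ℝ (L x) v v = fderiv ℝ (L x) v (∑ a, v a • (Pi.single a 1 : Vec m)) :=
    congrArg _ hv
  rw [h6, map_sum]
  refine Finset.sum_congr rfl fun a _ => ?_
  rw [map_smul, smul_eq_mul]
  rfl


theorem euler2
    (hO : IsOpen Ω) (hL : Sm Ω L)
    (hE : ∀ p ∈ Ω, ∑ a, p.2 a * pdv L a p.1 p.2 = 2 * L p.1 p.2)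
    {x v : Vec m} (hp : (x, v) ∈ Ω) (b : Fin m) :
    ∑ a, v a * gmet L x v b a = pdv L b x v := by
  have h1 := pdv_congr hO (f := fun x v => ∑ a, v a * pdv L a x v) (h := fun x v => 2 * L x v)
    hE hp b
  rw [pdv_euler hO (fun a => hL.pdv hO a) hp, pdv_const_mul hO hL 2 hp] at h1
  have : ∑ a, v a * gmet L x v b a = ∑ a, v a * pdv (pdv L a) b x v := rfl
  rw [this]; linarith

theorem euler3
    (hO : IsOpen Ω) (hL : Sm Ω L)
    (hE : ∀ p ∈ Ω, ∑ a, p.2 a * pdv L a p.1 p.2 = 2 * L p.1 p.2)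
    {x v : Vec m} (hp : (x, v) ∈ Ω) (b c : Fin m) :
    ∑ a, v a * pdv (fun y w => gmet L y w b a) c x v = 0 := by
  have h1 := pdv_congr hO (f := fun x v => ∑ a, v a * gmet L x v b a) (h := pdv L b)
    (fun p hp => euler2 hO hL hE (x := p.1) (v := p.2) hp b) hp c
  rw [pdv_euler hO (f := fun a x v => gmet L x v b a) (fun a => sm_g hO hL b a) hp] at h1
  have h2 : gmet L x v b c = pdv (pdv L b) c x v := g_symm hO hL hp b c
  linarith

theorem g_congr_v
    (hO : IsOpen Ω) (hL : Sm Ω L)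
    (hE : ∀ p ∈ Ω, ∑ a, p.2 a * pdv L a p.1 p.2 = 2 * L p.1 p.2)
    {x v : Vec m} (hp : (x, v) ∈ Ω) (a b c : Fin m) :
    pdv (fun y w => gmet L y w a b) c x v = pdv (fun y w => gmet L y w b a) c x v :=
  pdv_congr hO (f := fun y w => gmet L y w a b) (h := fun y w => gmet L y w b a)
    (fun p hp => g_symm hO hL (x := p.1) (v := p.2) hp a b) hp c

theorem g_congr_x
    (hO : IsOpen Ω) (hL : Sm Ω L)
    (hE : ∀ p ∈ Ω, ∑ a, p.2 a * pdv L a p.1 p.2 = 2 * L p.1 p.2)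
    {x v : Vec m} (hp : (x, v) ∈ Ω) (a b c : Fin m) :
    pdx (fun y w => gmet L y w a b) c x v = pdx (fun y w => gmet L y w b a) c x v :=
  pdx_congr hO (f := fun y w => gmet L y w a b) (h := fun y w => gmet L y w b a)
    (fun p hp => g_symm hO hL (x := p.1) (v := p.2) hp a b) hp c

theorem C_symm
    (hO : IsOpen Ω) (hL : Sm Ω L)
    (hE : ∀ p ∈ Ω, ∑ a, p.2 a * pdv L a p.1 p.2 = 2 * L p.1 p.2)
    {x v : Vec m} (hp : (x, v) ∈ Ω) (a b c : Fin m) :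
    pdv (fun y w => gmet L y w a b) c x v = pdv (fun y w => gmet L y w a c) b x v := by
  rw [g_congr_v hO hL hE hp a b c, g_congr_v hO hL hE hp a c b]
  exact pdv_pdv hO (hL.pdv hO a) hp b c

theorem xg
    (hO : IsOpen Ω) (hL : Sm Ω L)
    (hE : ∀ p ∈ Ω, ∑ a, p.2 a * pdv L a p.1 p.2 = 2 * L p.1 p.2)
    {x v : Vec m} (hp : (x, v) ∈ Ω) (b c : Fin m) :
    ∑ a, v a * pdx (fun y w => gmet L y w b a) c x v = pdx (pdv L b) c x v := by
  rw [← pdx_euler hO (f := fun a x v => gmet L x v b a) (fun a => sm_g hO hL b a) hp]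
  exact pdx_congr hO (f := fun x v => ∑ a, v a * gmet L x v b a) (h := pdv L b)
    (fun p hp => euler2 hO hL hE (x := p.1) (v := p.2) hp b) hp c

theorem xL
    (hO : IsOpen Ω) (hL : Sm Ω L)
    (hE : ∀ p ∈ Ω, ∑ a, p.2 a * pdv L a p.1 p.2 = 2 * L p.1 p.2)
    {x v : Vec m} (hp : (x, v) ∈ Ω) (c : Fin m) :
    ∑ a, v a * pdx (pdv L a) c x v = 2 * pdx L c x v := by
  rw [← pdx_euler hO (fun a => hL.pdv hO a) hp, ← pdx_const_mul hO hL 2 hp]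
  exact pdx_congr hO (f := fun x v => ∑ a, v a * pdv L a x v) (h := fun x v => 2 * L x v)
    hE hp c

/-- the lowered spray bracket -/
theorem bracket_eq
    (hO : IsOpen Ω) (hL : Sm Ω L)
    (hE : ∀ p ∈ Ω, ∑ a, p.2 a * pdv L a p.1 p.2 = 2 * L p.1 p.2)
    {x v : Vec m} (hp : (x, v) ∈ Ω) (δ : Fin m) :
    (∑ β, ∑ γ,
      (pdx (fun y w => gmet L y w δ γ) β x v
        + pdx (fun y w => gmet L y w δ β) γ x v
        - pdx (fun y w => gmet L y w β γ) δ x v) * v β * v γ)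
      = 2 * ∑ β, v β * pdx (pdv L δ) β x v - 2 * pdx L δ x v := by
  have e1 : ∑ β, ∑ γ, v β * (v γ * pdx (fun y w => gmet L y w δ γ) β x v)
      = ∑ β, v β * pdx (pdv L δ) β x v := by
    refine Finset.sum_congr rfl fun β _ => ?_
    rw [← Finset.mul_sum, xg hO hL hE hp]
  have e2 : ∑ β, ∑ γ, v γ * (v β * pdx (fun y w => gmet L y w δ β) γ x v)
      = ∑ β, v β * pdx (pdv L δ) β x v := by
    rw [Finset.sum_comm]; exact e1
  have e3 : ∑ β, ∑ γ, v β * (v γ * pdx (fun y w => gmet L y w β γ) δ x v)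
      = 2 * pdx L δ x v := by
    rw [← xL hO hL hE hp]
    refine Finset.sum_congr rfl fun β _ => ?_
    rw [← Finset.mul_sum, xg hO hL hE hp]
  have : ∀ β γ, (pdx (fun y w => gmet L y w δ γ) β x v
        + pdx (fun y w => gmet L y w δ β) γ x v
        - pdx (fun y w => gmet L y w β γ) δ x v) * v β * v γ
      = v β * (v γ * pdx (fun y w => gmet L y w δ γ) β x v)
       + v γ * (v β * pdx (fun y w => gmet L y w δ β) γ x v)
       - v β * (v γ * pdx (fun y w => gmet L y w β γ) δ x v) := fun β γ => by ring
  simp only [this, Finset.sum_add_distrib, Finset.sum_sub_distrib]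
  rw [e1, e2, e3]; ring


theorem sm_spray
    (hO : IsOpen Ω) (hL : Sm Ω L)
    (hE : ∀ p ∈ Ω, ∑ a, p.2 a * pdv L a p.1 p.2 = 2 * L p.1 p.2)
    (hI : ∀ p ∈ Ω, IsUnit (gmet L p.1 p.2).det)
    (α : Fin m) : Sm Ω (spray L α) := by
  unfold spray
  refine sm_mul (sm_const _) (sm_sum fun δ => sm_mul (sm_inv (sm_g hO hL) hI α δ)
    (sm_sum fun β => sm_sum fun γ => sm_mul (sm_mul ?_ (sm_coord β)) (sm_coord γ)))
  exact sm_sub (sm_add ((sm_g hO hL δ γ).pdx hO β) ((sm_g hO hL δ β).pdx hO γ))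
    ((sm_g hO hL β γ).pdx hO δ)

theorem g_mul_inv
    (hO : IsOpen Ω) (hL : Sm Ω L)
    (hE : ∀ p ∈ Ω, ∑ a, p.2 a * pdv L a p.1 p.2 = 2 * L p.1 p.2)
    (hI : ∀ p ∈ Ω, IsUnit (gmet L p.1 p.2).det)
    {x v : Vec m} (hp : (x, v) ∈ Ω) (w : Fin m → ℝ) (δ : Fin m) :
    ∑ α, gmet L x v δ α * ∑ σ, (gmet L x v)⁻¹ α σ * w σ = w δ := by
  have h := congrFun (congrArg (fun A => Matrix.mulVec A w)
    (Matrix.mul_nonsing_inv _ (hI (x, v) hp))) δ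
  simp only [← Matrix.mulVec_mulVec, Matrix.one_mulVec] at h
  exact h

theorem inv_mul_g
    (hO : IsOpen Ω) (hL : Sm Ω L)
    (hE : ∀ p ∈ Ω, ∑ a, p.2 a * pdv L a p.1 p.2 = 2 * L p.1 p.2)
    (hI : ∀ p ∈ Ω, IsUnit (gmet L p.1 p.2).det)
    {x v : Vec m} (hp : (x, v) ∈ Ω) (w : Fin m → ℝ) (δ : Fin m) :
    ∑ α, (gmet L x v)⁻¹ δ α * ∑ σ, gmet L x v α σ * w σ = w δ := by
  have h := congrFun (congrArg (fun A => Matrix.mulVec A w)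
    (Matrix.nonsing_inv_mul _ (hI (x, v) hp))) δ
  simp only [← Matrix.mulVec_mulVec, Matrix.one_mulVec] at h
  exact h

theorem g_inj
    (hO : IsOpen Ω) (hL : Sm Ω L)
    (hE : ∀ p ∈ Ω, ∑ a, p.2 a * pdv L a p.1 p.2 = 2 * L p.1 p.2)
    (hI : ∀ p ∈ Ω, IsUnit (gmet L p.1 p.2).det)
    {x v : Vec m} (hp : (x, v) ∈ Ω) {u w : Fin m → ℝ}
    (h : ∀ δ, ∑ α, gmet L x v δ α * u α = ∑ α, gmet L x v δ α * w α) (α : Fin m) :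
    u α = w α := by
  rw [← inv_mul_g hO hL hE hI hp u α, ← inv_mul_g hO hL hE hI hp w α]
  simp only [h]

theorem gG
    (hO : IsOpen Ω) (hL : Sm Ω L)
    (hE : ∀ p ∈ Ω, ∑ a, p.2 a * pdv L a p.1 p.2 = 2 * L p.1 p.2)
    (hI : ∀ p ∈ Ω, IsUnit (gmet L p.1 p.2).det)
    {x v : Vec m} (hp : (x, v) ∈ Ω) (δ : Fin m) :
    ∑ α, gmet L x v δ α * spray L α x v
      = (1/2) * ((∑ β, v β * pdx (pdv L δ) β x v) - pdx L δ x v) := by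
  have h := g_mul_inv hO hL hE hI hp
    (fun δ => 2 * ∑ β, v β * pdx (pdv L δ) β x v - 2 * pdx L δ x v) δ
  have : ∑ α, gmet L x v δ α * spray L α x v = (1/4) * ∑ α, gmet L x v δ α *
      ∑ σ, (gmet L x v)⁻¹ α σ * (2 * ∑ β, v β * pdx (pdv L σ) β x v - 2 * pdx L σ x v) := by
    rw [Finset.mul_sum]
    refine Finset.sum_congr rfl fun α _ => ?_
    unfold spray ginv
    simp only [bracket_eq hO hL hE hp]
    ring
  rw [this, h]; ring

theorem gN
    (hO : IsOpen Ω) (hL : Sm Ω L)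
    (hE : ∀ p ∈ Ω, ∑ a, p.2 a * pdv L a p.1 p.2 = 2 * L p.1 p.2)
    (hI : ∀ p ∈ Ω, IsUnit (gmet L p.1 p.2).det)
    {x v : Vec m} (hp : (x, v) ∈ Ω) (δ μ : Fin m) :
    2 * ∑ α, gmet L x v δ α * nConn L α μ x v
      = pdx (pdv L δ) μ x v + (∑ β, v β * pdx (fun y w => gmet L y w δ μ) β x v)
        - pdx (pdv L μ) δ x v
        - 2 * ∑ α, pdv (fun y w => gmet L y w δ α) μ x v * spray L α x v := by
  have h := pdv_congr hO (f := fun x v => ∑ α, gmet L x v δ α * spray L α x v)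
    (h := fun x v => (1/2) * ((∑ β, v β * pdx (pdv L δ) β x v) - pdx L δ x v))
    (fun p hp => gG hO hL hE hI (x := p.1) (v := p.2) hp δ) hp μ
  have sP : ∀ β, Sm Ω (pdx (pdv L δ) β) := fun β => (hL.pdv hO δ).pdx hO β
  have sS : Sm Ω (fun x v => ∑ β, v β * pdx (pdv L δ) β x v) :=
    sm_sum fun β => sm_mul (sm_coord β) (sP β)
  rw [pdv_sum_mul hO (f := fun α x v => gmet L x v δ α) (fun α => sm_g hO hL δ α)
    (fun α => sm_spray hO hL hE hI α) hp,
    pdv_const_mul hO (f := fun x v => (∑ β, v β * pdx (pdv L δ) β x v) - pdx L δ x v)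
      (sm_sub sS (hL.pdx hO δ)) _ hp,
    pdv_sub hO (f := fun x v => ∑ β, v β * pdx (pdv L δ) β x v) sS (hL.pdx hO δ) hp,
    pdv_euler hO sP hp, pdv_pdx hO hL hp δ μ, Finset.sum_add_distrib] at h
  have e : ∑ β, v β * pdv (pdx (pdv L δ) β) μ x v
      = ∑ β, v β * pdx (fun y w => gmet L y w δ μ) β x v := by
    refine Finset.sum_congr rfl fun β _ => ?_
    rw [pdv_pdx hO (hL.pdv hO δ) hp, g_congr_x hO hL hE hp δ μ]
    rfl
  rw [e] at h
  have e2 : ∑ α, gmet L x v δ α * nConn L α μ x v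
    = ∑ α, gmet L x v δ α * pdv (spray L α) μ x v := rfl
  rw [e2]
  linarith

theorem Nv
    (hO : IsOpen Ω) (hL : Sm Ω L)
    (hE : ∀ p ∈ Ω, ∑ a, p.2 a * pdv L a p.1 p.2 = 2 * L p.1 p.2)
    (hI : ∀ p ∈ Ω, IsUnit (gmet L p.1 p.2).det)
    {x v : Vec m} (hp : (x, v) ∈ Ω) (α : Fin m) :
    ∑ μ, v μ * nConn L α μ x v = 2 * spray L α x v := by
  refine g_inj hO hL hE hI hp (u := fun α => ∑ μ, v μ * nConn L α μ x v)
    (w := fun α => 2 * spray L α x v) (fun δ => ?_) α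
  have h1 : ∑ α, gmet L x v δ α * ∑ μ, v μ * nConn L α μ x v
      = (1/2) * ∑ μ, v μ * (2 * ∑ α, gmet L x v δ α * nConn L α μ x v) := by
    simp only [Finset.mul_sum]
    rw [Finset.sum_comm]
    refine Finset.sum_congr rfl fun a _ => Finset.sum_congr rfl fun b _ => by ring
  have h2 : ∑ α, gmet L x v δ α * (2 * spray L α x v)
      = 2 * ∑ α, gmet L x v δ α * spray L α x v := by
    rw [Finset.mul_sum]; exact Finset.sum_congr rfl fun b _ => by ring
  have hC : ∑ μ, v μ * ∑ α, pdv (fun y w => gmet L y w δ α) μ x v * spray L α x v = 0 := by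
    simp only [Finset.mul_sum]
    rw [Finset.sum_comm]
    refine Finset.sum_eq_zero fun α _ => ?_
    have := euler3 hO hL hE hp δ α
    calc _ = (∑ a, v a * pdv (fun y w => gmet L y w δ a) α x v) * spray L α x v := by
          rw [Finset.sum_mul]
          refine Finset.sum_congr rfl fun a _ => ?_
          rw [C_symm hO hL hE hp δ α a]; ring
      _ = 0 := by rw [this]; ring
  have hQ : ∑ μ, v μ * ∑ β, v β * pdx (fun y w => gmet L y w δ μ) β x v
      = ∑ β, v β * pdx (pdv L δ) β x v := by
    simp only [Finset.mul_sum]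
    rw [Finset.sum_comm]
    refine Finset.sum_congr rfl fun β _ => ?_
    rw [← xg hO hL hE hp δ β, Finset.mul_sum]
    exact Finset.sum_congr rfl fun a _ => by ring
  have hX := xL hO hL hE hp δ
  rw [h1, h2, gG hO hL hE hI hp]
  simp only [gN hO hL hE hI hp]
  have : ∀ μ, v μ * (pdx (pdv L δ) μ x v + (∑ β, v β * pdx (fun y w => gmet L y w δ μ) β x v)
        - pdx (pdv L μ) δ x v
        - 2 * ∑ α, pdv (fun y w => gmet L y w δ α) μ x v * spray L α x v)
      = v μ * pdx (pdv L δ) μ x v + v μ * (∑ β, v β * pdx (fun y w => gmet L y w δ μ) β x v)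
        - v μ * pdx (pdv L μ) δ x v
        - 2 * (v μ * ∑ α, pdv (fun y w => gmet L y w δ α) μ x v * spray L α x v) :=
    fun μ => by ring
  simp only [this, Finset.sum_add_distrib, Finset.sum_sub_distrib]
  rw [← Finset.mul_sum (a := (2 : ℝ)), hC, hQ, hX]; ring

theorem pdm_chain (hO : IsOpen Ω) (hL : Sm Ω L) {s : Vec m → Vec m} {x : Vec m}
    (hs : DifferentiableAt ℝ s x) (hp : (x, s x) ∈ Ω) (a b μ : Fin m) :
    pdm (fun y => gmet L y (s y)) a b μ x = pdx (fun y w => gmet L y w a b) μ x (s x)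
      + ∑ ρ, pdv (fun y w => gmet L y w a b) ρ x (s x) * pde s ρ μ x := by
  have hg := sm_g hO hL a b
  have h1 := (hg.diff hO hp).hasFDerivAt
  have h2 : HasFDerivAt (fun y => (y, s y))
      ((ContinuousLinearMap.id ℝ (Vec m)).prod (fderiv ℝ s x)) x :=
    (hasFDerivAt_id x).prodMk hs.hasFDerivAt
  have h3 := HasFDerivAt.comp x (f := fun y => (y, s y)) h1 h2
  have h4 : pdm (fun y => gmet L y (s y)) a b μ x =
    fderiv ℝ ((fun p : Vec m × Vec m => gmet L p.1 p.2 a b) ∘ fun y => (y, s y)) x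
      (Pi.single μ 1) := rfl
  rw [h4, h3.fderiv, pdx_eq hO hg hp]
  simp only [pdv_eq hO hg hp]
  have h5 : ∀ ρ, pde s ρ μ x = fderiv ℝ s x (Pi.single μ 1) ρ := by
    intro ρ
    unfold pde
    rw [((hasFDerivAt_pi'.1 hs.hasFDerivAt) ρ).fderiv]
    rfl
  simp only [h5, ContinuousLinearMap.comp_apply, ContinuousLinearMap.prod_apply,
    ContinuousLinearMap.id_apply]
  set w := fderiv ℝ s x (Pi.single μ 1)
  have h6 : ((Pi.single μ 1, w) : Vec m × Vec m)
      = (Pi.single μ 1, 0) + ∑ ρ, w ρ • ((0, Pi.single ρ 1) : Vec m × Vec m) := by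
    ext j
    · simp [Prod.fst_sum]
    · simp [Prod.snd_sum, Finset.sum_apply, Pi.single_apply]
  rw [h6, map_add, map_sum]
  congr 1
  refine Finset.sum_congr rfl fun ρ _ => ?_
  rw [map_smul, smul_eq_mul, mul_comm]

theorem key (hO : IsOpen Ω) (hL : Sm Ω L)
    (hE : ∀ p ∈ Ω, ∑ a, p.2 a * pdv L a p.1 p.2 = 2 * L p.1 p.2)
    (hI : ∀ p ∈ Ω, IsUnit (gmet L p.1 p.2).det) {s : Vec m → Vec m} {x : Vec m}
    (hs : DifferentiableAt ℝ s x) (hp : (x, s x) ∈ Ω) (c : ℝ)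
    (hpre : ∀ α, covD L s s x α = c * s x α) (lam μ : Fin m) :
    ∑ ν, christ (fun y => gmet L y (s y)) lam ν μ x * s x ν = nConn L lam μ x (s x) := by
  have hD : ∀ ρ, ∑ ν, s x ν * pde s ρ ν x = c * s x ρ - 2 * spray L ρ x (s x) := by
    intro ρ
    rw [← hpre ρ, ← Nv hO hL hE hI hp ρ, covD, ← Finset.sum_sub_distrib]
    exact Finset.sum_congr rfl fun a _ => by ring
  have e3' : ∀ a b, ∑ ρ, pdv (fun y w => gmet L y w a b) ρ x (s x) * s x ρ = 0 := by
    intro a b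
    rw [← euler3 hO hL hE hp a b]
    exact Finset.sum_congr rfl fun ρ _ => by rw [C_symm hO hL hE hp a b ρ]; ring
  have t1 : ∀ σ, ∑ ν, s x ν * pdm (fun y => gmet L y (s y)) σ μ ν x
      = (∑ β, s x β * pdx (fun y w => gmet L y w σ μ) β x (s x))
        - 2 * ∑ α, pdv (fun y w => gmet L y w σ α) μ x (s x) * spray L α x (s x) := by
    intro σ
    simp only [pdm_chain hO hL hs hp, mul_add, Finset.sum_add_distrib]
    rw [sub_eq_add_neg]
    congr 1
    simp only [Finset.mul_sum]
    rw [Finset.sum_comm]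
    calc _ = ∑ ρ, pdv (fun y w => gmet L y w σ μ) ρ x (s x) * ∑ ν, s x ν * pde s ρ ν x := by
          refine Finset.sum_congr rfl fun ρ _ => ?_
          rw [Finset.mul_sum]
          exact Finset.sum_congr rfl fun ν _ => by ring
      _ = c * (∑ ρ, pdv (fun y w => gmet L y w σ μ) ρ x (s x) * s x ρ)
          - ∑ ρ, 2 * (pdv (fun y w => gmet L y w σ ρ) μ x (s x) * spray L ρ x (s x)) := by
          rw [Finset.mul_sum, ← Finset.sum_sub_distrib]
          refine Finset.sum_congr rfl fun ρ _ => ?_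
          rw [hD, C_symm hO hL hE hp σ ρ μ]; ring
      _ = _ := by rw [e3']; ring
  have t2 : ∀ σ τ, ∑ ν, s x ν * pdm (fun y => gmet L y (s y)) σ ν τ x
      = pdx (pdv L σ) τ x (s x) := by
    intro σ τ
    simp only [pdm_chain hO hL hs hp, mul_add, Finset.sum_add_distrib]
    rw [xg hO hL hE hp, add_eq_left]
    simp only [Finset.mul_sum]
    rw [Finset.sum_comm]
    refine Finset.sum_eq_zero fun ρ _ => ?_
    calc _ = (∑ ν, s x ν * pdv (fun y w => gmet L y w σ ν) ρ x (s x)) * pde s ρ τ x := by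
          rw [Finset.sum_mul]
          exact Finset.sum_congr rfl fun ν _ => by ring
      _ = 0 := by rw [euler3 hO hL hE hp]; ring
  have t3 : ∀ σ, ∑ ν, s x ν * pdm (fun y => gmet L y (s y)) ν μ σ x
      = pdx (pdv L μ) σ x (s x) := by
    intro σ
    rw [← t2 μ σ]
    refine Finset.sum_congr rfl fun ν _ => ?_
    simp only [pdm_chain hO hL hs hp]
    rw [g_congr_x hO hL hE hp ν μ]
    simp only [g_congr_v hO hL hE hp ν μ]
  have t : ∀ σ, ∑ ν, s x ν * (pdm (fun y => gmet L y (s y)) σ μ ν x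
      + pdm (fun y => gmet L y (s y)) σ ν μ x - pdm (fun y => gmet L y (s y)) ν μ σ x)
      = 2 * ∑ α, gmet L x (s x) σ α * nConn L α μ x (s x) := by
    intro σ
    rw [gN hO hL hE hI hp σ μ]
    simp only [mul_add, mul_sub, Finset.sum_add_distrib, Finset.sum_sub_distrib]
    rw [t1, t2, t3]; ring
  rw [← inv_mul_g hO hL hE hI hp (fun α => nConn L α μ x (s x)) lam]
  unfold christ
  calc _ = (1/2) * ∑ σ, (gmet L x (s x))⁻¹ lam σ * ∑ ν, s x ν *
          (pdm (fun y => gmet L y (s y)) σ μ ν x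
      + pdm (fun y => gmet L y (s y)) σ ν μ x - pdm (fun y => gmet L y (s y)) ν μ σ x) := by
        simp only [Finset.mul_sum, Finset.sum_mul]
        rw [Finset.sum_comm]
        exact Finset.sum_congr rfl fun ν _ => Finset.sum_congr rfl fun σ _ => by ring
    _ = _ := by
        simp only [t]
        rw [Finset.mul_sum]
        exact Finset.sum_congr rfl fun σ _ => by ring

theorem christ_symm (hO : IsOpen Ω) (hL : Sm Ω L)
    (hE : ∀ p ∈ Ω, ∑ a, p.2 a * pdv L a p.1 p.2 = 2 * L p.1 p.2)
    {s : Vec m → Vec m} {x : Vec m}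
    (hs : DifferentiableAt ℝ s x) (hp : (x, s x) ∈ Ω) (lam μ ν : Fin m) :
    christ (fun y => gmet L y (s y)) lam ν μ x = christ (fun y => gmet L y (s y)) lam μ ν x := by
  unfold christ
  congr 1
  refine Finset.sum_congr rfl fun σ _ => ?_
  have : pdm (fun y => gmet L y (s y)) ν μ σ x = pdm (fun y => gmet L y (s y)) μ ν σ x := by
    simp only [pdm_chain hO hL hs hp]
    rw [g_congr_x hO hL hE hp ν μ]
    simp only [g_congr_v hO hL hE hp ν μ]
  rw [this]; ring

end PF

/-- Corollary (Cor. 2.6, Eqs. (mnr1)-(mnr2)): if `s` is pregeodesic (`D_s s = f·s`)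
then `D_X s = ∇^{g_s}_X s` and `D̃_s X = ∇^{g_s}_s X` on `U`. -/
theorem statement8 {m : ℕ} (hm : 2 ≤ m)
    (Ω : Set (Vec m × Vec m)) (hΩopen : IsOpen Ω) (hΩne : Ω.Nonempty)
    (hΩslit : ∀ p ∈ Ω, p.2 ≠ 0)
    (hΩcone : ∀ p ∈ Ω, ∀ s : ℝ, 0 < s → (p.1, s • p.2) ∈ Ω)
    (L : Vec m → Vec m → ℝ)
    (hLsmooth : ContDiffOn ℝ (⊤ : ℕ∞) (fun p : Vec m × Vec m => L p.1 p.2) Ω)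
    (hLhom : ∀ p ∈ Ω, ∀ s : ℝ, 0 < s → L p.1 (s • p.2) = s ^ 2 * L p.1 p.2)
    (hLinv : ∀ p ∈ Ω, IsUnit (gmet L p.1 p.2).det)
    (U : Set (Vec m)) (hUopen : IsOpen U)
    (s : Vec m → Vec m) (hssmooth : ContDiffOn ℝ (⊤ : ℕ∞) s U)
    (hsΩ : ∀ x ∈ U, (x, s x) ∈ Ω)
    (f : Vec m → ℝ) (hfsmooth : ContDiffOn ℝ (⊤ : ℕ∞) f U)
    (hpregeo : ∀ x ∈ U, ∀ α, covD L s s x α = f x * s x α) :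
    ∀ (X : Vec m → Vec m), ContDiffOn ℝ (⊤ : ℕ∞) X U →
      ∀ x ∈ U, ∀ α,
        covD L s X x α = lcCov (fun y => gmet L y (s y)) X s x α
        ∧ flipD L s X x α = lcCov (fun y => gmet L y (s y)) s X x α := by
  intro X _ x hx α
  have hE : ∀ p ∈ Ω, ∑ a, p.2 a * pdv L a p.1 p.2 = 2 * L p.1 p.2 := fun p hp =>
    PF.euler1 hΩopen hLsmooth hLhom (x := p.1) (v := p.2) hp
  have hs : DifferentiableAt ℝ s x :=
    (hssmooth.contDiffAt (hUopen.mem_nhds hx)).differentiableAt (by simp)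
  have hp := hsΩ x hx
  have K := PF.key hΩopen hLsmooth hE hLinv hs hp (f x) (hpregeo x hx)
  constructor
  · simp only [covD, lcCov, add_mul, Finset.sum_add_distrib]
    congr 1
    · exact Finset.sum_congr rfl fun μ _ => by ring
    · refine Finset.sum_congr rfl fun μ _ => ?_
      rw [← K α μ, Finset.sum_mul]
  · simp only [flipD, lcCov]
    congr 1
    · exact Finset.sum_congr rfl fun μ _ => by ring
    · rw [Finset.sum_comm]
      refine Finset.sum_congr rfl fun ν _ => ?_
      rw [← K α ν, Finset.sum_mul]
      refine Finset.sum_congr rfl fun μ _ => ?_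
      rw [PF.christ_symm hΩopen hLsmooth hE hs hp α ν μ]
      ring
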